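/- Let u ∈ L^∞(ℝ^d; ℝ^d), let x₀ ∈ ℝ^d, and let (u⁺, u⁻, ν) ∈ ℝ^d × ℝ^d × S^{d−1} be such that u admits the blow-up v(z) = u⁺ 1_{⟨z,ν⟩ ≥ 0}(z) + u⁻ 1_{⟨z,ν⟩ < 0}(z) at x₀ (the case u⁺ = u⁻ is allowed). Let ρ ∈ K be a radial convolution kernel and write u_ℓ = u ∗ ρ_ℓ. Then lim_{ℓ→0⁺} [ ((u ⊗ u) ∗ ρ_ℓ − u_ℓ ⊗ u_ℓ) ∗ ρ_ℓ ](x₀) = ᾱ (u⁺ − u⁻) ⊗ (u⁺ − u⁻), where α_ν(y) := ∫_{B₁(y) ∩ {⟨z,ν⟩ ≥ 0}} ρ(y − z) dz and ᾱ := ∫_{B₁} α_ν(y) (1 − α_ν(y)) ρ(y) dy. -/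

import Mathlib

open MeasureTheory Filter Metric Set
open scoped Topology RealInnerProductSpace

noncomputable section

/-- The class `K` of admissible convolution kernels: smooth, compactly supported in the open
unit ball, even, with unit mass. -/
structure IsKernel (d : ℕ) (ρ : EuclideanSpace ℝ (Fin d) → ℝ) : Prop where
  smooth : ContDiff ℝ (⊤ : ℕ∞) ρ
  supp : tsupport ρ ⊆ Metric.ball 0 1
  even : ∀ z, ρ (-z) = ρ z
  mass : (∫ z, ρ z) = 1

/-- `u` admits the blow-up `v` at `x₀`:
`∫_{B₁} ‖u (x₀ + ℓ z) - v z‖ dz → 0` as `ℓ → 0⁺`. -/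
def HasBlowUp {d : ℕ} {F : Type*} [NormedAddCommGroup F]
    (u : EuclideanSpace ℝ (Fin d) → F) (x₀ : EuclideanSpace ℝ (Fin d))
    (v : EuclideanSpace ℝ (Fin d) → F) : Prop :=
  Filter.Tendsto (fun ℓ : ℝ => ∫ z in Metric.ball (0 : EuclideanSpace ℝ (Fin d)) 1,
      ‖u (x₀ + ℓ • z) - v z‖) (𝓝[>] (0:ℝ)) (𝓝 0)

/-- The mollification `(u ∗ ρ_ℓ)(x) = ∫ ρ_ℓ(y) u (x - y) dy`, with
`ρ_ℓ(y) = ℓ^{-d} ρ(y/ℓ)`. -/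
noncomputable def mollify {d : ℕ} {F : Type*} [NormedAddCommGroup F] [NormedSpace ℝ F]
    [CompleteSpace F]
    (ρ : EuclideanSpace ℝ (Fin d) → ℝ) (u : EuclideanSpace ℝ (Fin d) → F) (ℓ : ℝ)
    (x : EuclideanSpace ℝ (Fin d)) : F :=
  ∫ y, ((ℓ ^ d)⁻¹ * ρ (ℓ⁻¹ • y)) • u (x - y)

/-- The jump blow-up profile `v(z) = u⁺ 1_{⟨z,ν⟩ ≥ 0}(z) + u⁻ 1_{⟨z,ν⟩ < 0}(z)`. -/
def jumpFn {d : ℕ} {F : Type*} (up um : F) (ν : EuclideanSpace ℝ (Fin d)) :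
    EuclideanSpace ℝ (Fin d) → F :=
  fun z => if 0 ≤ ⟪z, ν⟫ then up else um

/-- The tensor product `(a ⊗ b)_{ij} = aᵢ bⱼ`, as a `d × d` real matrix. -/
def tensor {d : ℕ} (a b : EuclideanSpace ℝ (Fin d)) : Fin d → Fin d → ℝ :=
  fun i j => a i * b j

/-- `α_ν(y) = ∫_{B₁(y) ∩ {⟨z,ν⟩ ≥ 0}} ρ(y - z) dz`. -/
noncomputable def alphaNu {d : ℕ} (ρ : EuclideanSpace ℝ (Fin d) → ℝ)
    (ν : EuclideanSpace ℝ (Fin d)) (y : EuclideanSpace ℝ (Fin d)) : ℝ :=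
  ∫ z in Metric.ball y 1 ∩ {z | 0 ≤ ⟪z, ν⟫}, ρ (y - z)

namespace IsKernel

variable {d : ℕ} {ρ : EuclideanSpace ℝ (Fin d) → ℝ}

lemma hasCompactSupport (hρ : IsKernel d ρ) : HasCompactSupport ρ :=
  (isCompact_closedBall (0 : EuclideanSpace ℝ (Fin d)) 1).of_isClosed_subset
    (isClosed_tsupport ρ) (hρ.supp.trans ball_subset_closedBall)

lemma integrable (hρ : IsKernel d ρ) : Integrable ρ :=
  hρ.smooth.continuous.integrable_of_hasCompactSupport hρ.hasCompactSupport

lemma eq_zero_of_notMem_ball (hρ : IsKernel d ρ) {z : EuclideanSpace ℝ (Fin d)}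
    (hz : z ∉ ball (0 : EuclideanSpace ℝ (Fin d)) 1) : ρ z = 0 :=
  image_eq_zero_of_notMem_tsupport fun h => hz (hρ.supp h)

lemma exists_bound (hρ : IsKernel d ρ) : ∃ M, 0 ≤ M ∧ ∀ z, |ρ z| ≤ M := by
  obtain ⟨M, hM⟩ := hρ.hasCompactSupport.exists_bound_of_continuous hρ.smooth.continuous
  exact ⟨M, (norm_nonneg _).trans (hM 0), hM⟩

end IsKernel

section Mollify

lemma jumpFn_smul {d : ℕ} {F : Type*} (a b : F) (ν z : EuclideanSpace ℝ (Fin d)) {r : ℝ} (hr : 0 < r) :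
    jumpFn a b ν (r • z) = jumpFn a b ν z := by
  simp only [jumpFn, real_inner_smul_left, mul_nonneg_iff_of_pos_left hr]

variable {d : ℕ} {F : Type*} [NormedAddCommGroup F] {ρ : EuclideanSpace ℝ (Fin d) → ℝ}

lemma stronglyMeasurable_jumpFn (a b : F) (ν : EuclideanSpace ℝ (Fin d)) :
    StronglyMeasurable (jumpFn a b ν) :=
  StronglyMeasurable.ite (measurableSet_le measurable_const (by fun_prop))
    stronglyMeasurable_const stronglyMeasurable_const

lemma norm_jumpFn_le (a b : F) (ν z : EuclideanSpace ℝ (Fin d)) :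
    ‖jumpFn a b ν z‖ ≤ ‖a‖ + ‖b‖ := by
  unfold jumpFn
  split_ifs
  · linarith [norm_nonneg b]
  · linarith [norm_nonneg a]

lemma integrableOn_norm_rescale_sub_jumpFn {f : EuclideanSpace ℝ (Fin d) → F}
    (hf : StronglyMeasurable f) {C : ℝ} (hC : ∀ x, ‖f x‖ ≤ C) (x₀ : EuclideanSpace ℝ (Fin d))
    (a b : F) (ν : EuclideanSpace ℝ (Fin d)) (ℓ : ℝ) :
    IntegrableOn (fun z => ‖f (x₀ + ℓ • z) - jumpFn a b ν z‖) (ball 0 1) := by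
  refine Measure.integrableOn_of_bounded (M := C + (‖a‖ + ‖b‖)) measure_ball_lt_top.ne ?_ ?_
  · exact (((hf.comp_measurable (by fun_prop)).sub
      (stronglyMeasurable_jumpFn a b ν)).norm).aestronglyMeasurable
  · refine Eventually.of_forall fun z => ?_
    rw [norm_norm]
    exact (norm_sub_le _ _).trans (add_le_add (hC _) (norm_jumpFn_le a b ν z))

variable [NormedSpace ℝ F]

lemma IsKernel.integrable_smul (hρ : IsKernel d ρ) {f : EuclideanSpace ℝ (Fin d) → F}
    (hf : StronglyMeasurable f) {C : ℝ} (hC : ∀ x, ‖f x‖ ≤ C) :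
    Integrable fun w => ρ w • f w :=
  hρ.integrable.smul_of_top_left
    (memLp_top_of_bound hf.aestronglyMeasurable C (Eventually.of_forall hC))

variable [CompleteSpace F]

lemma mollify_eq_integral (f : EuclideanSpace ℝ (Fin d) → F) {ℓ : ℝ} (hℓ : 0 < ℓ)
    (x : EuclideanSpace ℝ (Fin d)) :
    mollify ρ f ℓ x = ∫ w, ρ w • f (x - ℓ • w) := by
  have h := Measure.integral_comp_inv_smul_of_nonneg
    (volume : Measure (EuclideanSpace ℝ (Fin d))) (fun w => ρ w • f (x - ℓ • w)) hℓ.le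
  simp only [smul_inv_smul₀ hℓ.ne', finrank_euclideanSpace, Fintype.card_fin] at h
  simp only [mollify, mul_smul, integral_smul, h]
  rw [inv_smul_smul₀ (pow_pos hℓ d).ne']

lemma IsKernel.norm_mollify_le (hρ : IsKernel d ρ) {f : EuclideanSpace ℝ (Fin d) → F} {C : ℝ}
    (hC : ∀ x, ‖f x‖ ≤ C) {ℓ : ℝ} (hℓ : 0 < ℓ) (x : EuclideanSpace ℝ (Fin d)) :
    ‖mollify ρ f ℓ x‖ ≤ (∫ w, |ρ w|) * C := by
  rw [mollify_eq_integral f hℓ, ← integral_mul_const]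
  refine norm_integral_le_of_norm_le (hρ.integrable.abs.mul_const C) ?_
  refine Eventually.of_forall fun w => ?_
  rw [norm_smul, Real.norm_eq_abs]
  exact mul_le_mul_of_nonneg_left (hC _) (abs_nonneg _)

lemma IsKernel.stronglyMeasurable_mollify (hρ : IsKernel d ρ)
    {f : EuclideanSpace ℝ (Fin d) → F} (hf : StronglyMeasurable f) (ℓ : ℝ) :
    StronglyMeasurable (mollify ρ f ℓ) := by
  have hc := hρ.smooth.continuous
  have : StronglyMeasurable fun p : EuclideanSpace ℝ (Fin d) × EuclideanSpace ℝ (Fin d) =>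
      ((ℓ ^ d)⁻¹ * ρ (ℓ⁻¹ • p.2)) • f (p.1 - p.2) :=
    (Continuous.stronglyMeasurable (by fun_prop)).smul (hf.comp_measurable (by fun_prop))
  exact this.integral_prod_right

/-- The mollification at unit scale of the jump profile. -/
lemma IsKernel.integral_smul_jumpFn (hρ : IsKernel d ρ) (a b : F)
    (ν x : EuclideanSpace ℝ (Fin d)) :
    ∫ w, ρ w • jumpFn a b ν (x - w) = b + alphaNu ρ ν x • (a - b) := by
  set S : Set (EuclideanSpace ℝ (Fin d)) := {z | 0 ≤ ⟪z, ν⟫}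
  have hS : MeasurableSet S := measurableSet_le measurable_const (by fun_prop)
  have hi : Integrable fun z => ρ (x - z) := hρ.integrable.comp_sub_left x
  have hα : alphaNu ρ ν x = ∫ z, S.indicator (fun z => ρ (x - z)) z := by
    rw [integral_indicator hS, alphaNu, inter_comm, ← setIntegral_indicator measurableSet_ball]
    congr 1 with z
    refine indicator_apply_eq_self.2 fun hz => hρ.eq_zero_of_notMem_ball ?_
    rwa [mem_ball_zero_iff, ← dist_eq_norm, dist_comm]
  have h1 : ∫ z, ρ (x - z) = 1 := by
    rw [integral_sub_left_eq_self ρ volume x, hρ.mass]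
  calc ∫ w, ρ w • jumpFn a b ν (x - w)
      = ∫ z, ρ (x - z) • jumpFn a b ν z := by
        rw [← integral_sub_left_eq_self _ volume x]
        simp only [sub_sub_cancel]
    _ = ∫ z, (ρ (x - z) • b + S.indicator (fun z => ρ (x - z)) z • (a - b)) := by
        congr 1 with z
        by_cases hz : 0 ≤ ⟪z, ν⟫
        · rw [indicator_of_mem (show z ∈ S from hz), jumpFn, if_pos hz]
          module
        · rw [indicator_of_notMem (show z ∉ S from hz), jumpFn, if_neg hz]
          module
    _ = b + alphaNu ρ ν x • (a - b) := by
        rw [integral_add (hi.smul_const b) ((hi.indicator hS).smul_const _),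
          integral_smul_const, integral_smul_const, h1, one_smul, hα]

lemma IsKernel.norm_mollify_sub_le (hρ : IsKernel d ρ) {M : ℝ} (hM : ∀ z, |ρ z| ≤ M)
    {f : EuclideanSpace ℝ (Fin d) → F} (hf : StronglyMeasurable f) {C : ℝ}
    (hC : ∀ x, ‖f x‖ ≤ C) (x₀ : EuclideanSpace ℝ (Fin d)) (a b : F)
    (ν : EuclideanSpace ℝ (Fin d)) {x : EuclideanSpace ℝ (Fin d)}
    (hx : x ∈ ball (0 : EuclideanSpace ℝ (Fin d)) 1) {ℓ : ℝ} (hℓ : 0 < ℓ) :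
    ‖mollify ρ f ℓ (x₀ + ℓ • x) - (b + alphaNu ρ ν x • (a - b))‖ ≤
      2 ^ d * (M * ∫ z in ball (0 : EuclideanSpace ℝ (Fin d)) 1,
        ‖f (x₀ + (2 * ℓ) • z) - jumpFn a b ν z‖) := by
  set h : EuclideanSpace ℝ (Fin d) → ℝ := fun z => ‖f (x₀ + ℓ • z) - jumpFn a b ν z‖ with hh
  have hJ := stronglyMeasurable_jumpFn a b ν
  have hscale : ∀ y, h ((2 : ℝ) • y) = ‖f (x₀ + (2 * ℓ) • y) - jumpFn a b ν y‖ := fun y => by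
    simp only [hh, jumpFn_smul a b ν y two_pos, smul_smul, mul_comm]
  have hcov := Measure.integral_comp_smul (volume : Measure (EuclideanSpace ℝ (Fin d)))
    (fun z => |ρ (x - z)| * h z) 2
  rw [finrank_euclideanSpace, Fintype.card_fin, abs_of_pos (by positivity), smul_eq_mul,
    eq_inv_mul_iff_mul_eq₀ (by positivity)] at hcov
  calc ‖mollify ρ f ℓ (x₀ + ℓ • x) - (b + alphaNu ρ ν x • (a - b))‖
      = ‖∫ w, ρ w • (f (x₀ + ℓ • (x - w)) - jumpFn a b ν (x - w))‖ := by
        rw [mollify_eq_integral f hℓ, ← hρ.integral_smul_jumpFn, ← integral_sub]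
        · simp only [smul_sub, add_sub_assoc]
        · exact hρ.integrable_smul (hf.comp_measurable (by fun_prop)) fun w => hC _
        · exact hρ.integrable_smul (hJ.comp_measurable (by fun_prop))
            fun w => norm_jumpFn_le a b ν _
    _ ≤ ∫ w, |ρ w| * h (x - w) := by
        refine (norm_integral_le_integral_norm _).trans_eq ?_
        simp only [norm_smul, Real.norm_eq_abs, hh]
    _ = ∫ z, |ρ (x - z)| * h z := by
        rw [← integral_sub_left_eq_self _ volume x]
        simp only [sub_sub_cancel]
    _ = 2 ^ d * ∫ y, |ρ (x - (2 : ℝ) • y)| * h ((2 : ℝ) • y) := hcov.symm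
    _ ≤ _ := by
        gcongr
        rw [← integral_const_mul, ← integral_indicator measurableSet_ball]
        refine integral_mono_of_nonneg (Eventually.of_forall fun y => by positivity)
          (IntegrableOn.integrable_indicator ((integrableOn_norm_rescale_sub_jumpFn hf hC x₀ a b ν
            (2 * ℓ)).const_mul M) measurableSet_ball)
          (Eventually.of_forall fun y => ?_)
        simp only [hscale]
        by_cases hy : y ∈ ball (0 : EuclideanSpace ℝ (Fin d)) 1
        · rw [indicator_of_mem hy]
          exact mul_le_mul_of_nonneg_right (hM _) (norm_nonneg _)
        · rw [indicator_of_notMem hy, hρ.eq_zero_of_notMem_ball, abs_zero, zero_mul]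
          rw [mem_ball_zero_iff] at hx hy ⊢
          have h2 := norm_sub_norm_le ((2 : ℝ) • y) x
          rw [norm_smul, Real.norm_two, norm_sub_rev] at h2
          linarith

lemma HasBlowUp.tendsto_mollify (hρ : IsKernel d ρ) {f : EuclideanSpace ℝ (Fin d) → F}
    (hf : StronglyMeasurable f) {C : ℝ} (hC : ∀ x, ‖f x‖ ≤ C) {x₀ : EuclideanSpace ℝ (Fin d)}
    {a b : F} {ν : EuclideanSpace ℝ (Fin d)} (hb : HasBlowUp f x₀ (jumpFn a b ν))
    {x : EuclideanSpace ℝ (Fin d)} (hx : x ∈ ball (0 : EuclideanSpace ℝ (Fin d)) 1) :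
    Tendsto (fun ℓ : ℝ => mollify ρ f ℓ (x₀ + ℓ • x)) (𝓝[>] 0)
      (𝓝 (b + alphaNu ρ ν x • (a - b))) := by
  obtain ⟨M, -, hM⟩ := hρ.exists_bound
  have h2 : Tendsto (fun ℓ : ℝ => 2 * ℓ) (𝓝[>] 0) (𝓝[>] 0) := by
    refine tendsto_nhdsWithin_iff.2 ⟨?_, ?_⟩
    · exact (Continuous.tendsto' (by fun_prop) 0 0 (by simp)).mono_left nhdsWithin_le_nhds
    · filter_upwards [self_mem_nhdsWithin] with ℓ hℓ
      exact mul_pos two_pos (mem_Ioi.1 hℓ)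
  refine tendsto_iff_norm_sub_tendsto_zero.2 (squeeze_zero' (.of_forall fun _ => norm_nonneg _)
    ?_ (by simpa using ((hb.comp h2).const_mul M).const_mul (2 ^ d)))
  filter_upwards [self_mem_nhdsWithin] with ℓ hℓ
  exact hρ.norm_mollify_sub_le hM hf hC x₀ a b ν hx hℓ

end Mollify

section Tensor

variable {d : ℕ}

lemma continuous_tensor_self :
    Continuous fun a : EuclideanSpace ℝ (Fin d) => tensor a a := by
  unfold tensor
  fun_prop

lemma norm_tensor_le (a b : EuclideanSpace ℝ (Fin d)) : ‖tensor a b‖ ≤ ‖a‖ * ‖b‖ := by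
  refine (pi_norm_le_iff_of_nonneg (by positivity)).2 fun i =>
    (pi_norm_le_iff_of_nonneg (by positivity)).2 fun j => ?_
  rw [tensor, norm_mul]
  exact mul_le_mul (PiLp.norm_apply_le a i) (PiLp.norm_apply_le b j) (norm_nonneg _)
    (norm_nonneg _)

lemma norm_tensor_self_sub_le (a b : EuclideanSpace ℝ (Fin d)) :
    ‖tensor a a - tensor b b‖ ≤ (‖a‖ + ‖b‖) * ‖a - b‖ := by
  have h : tensor a a - tensor b b = tensor a (a - b) + tensor (a - b) b := by
    ext i j
    simp only [tensor, Pi.sub_apply, Pi.add_apply, PiLp.sub_apply]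
    ring
  rw [h]
  refine (norm_add_le _ _).trans
    ((add_le_add (norm_tensor_le _ _) (norm_tensor_le _ _)).trans_eq ?_)
  ring

lemma HasBlowUp.tensor_self {u : EuclideanSpace ℝ (Fin d) → EuclideanSpace ℝ (Fin d)}
    (hu : StronglyMeasurable u) {C : ℝ} (hC : ∀ x, ‖u x‖ ≤ C) {x₀ : EuclideanSpace ℝ (Fin d)}
    {a b ν : EuclideanSpace ℝ (Fin d)} (hb : HasBlowUp u x₀ (jumpFn a b ν)) :
    HasBlowUp (fun x => tensor (u x) (u x)) x₀ (jumpFn (tensor a a) (tensor b b) ν) := by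
  refine squeeze_zero (fun ℓ => integral_nonneg fun z => norm_nonneg _) (fun ℓ => ?_)
    (by simpa using hb.const_mul (C + (‖a‖ + ‖b‖)))
  rw [← integral_const_mul]
  refine integral_mono_of_nonneg (Eventually.of_forall fun z => norm_nonneg _)
    ((integrableOn_norm_rescale_sub_jumpFn hu hC x₀ a b ν ℓ).const_mul _)
    (Eventually.of_forall fun z => ?_)
  have hJ : jumpFn (tensor a a) (tensor b b) ν z
      = tensor (jumpFn a b ν z) (jumpFn a b ν z) := by
    unfold jumpFn
    split_ifs <;> rfl
  simp only [hJ]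
  refine (norm_tensor_self_sub_le _ _).trans ?_
  gcongr
  · exact hC _
  · exact norm_jumpFn_le a b ν z

lemma tensor_jump_defect (a b : EuclideanSpace ℝ (Fin d)) (t : ℝ) :
    tensor b b + t • (tensor a a - tensor b b) - tensor (b + t • (a - b)) (b + t • (a - b))
      = (t * (1 - t)) • tensor (a - b) (a - b) := by
  ext i j
  simp only [tensor, Pi.sub_apply, Pi.add_apply, Pi.smul_apply, PiLp.sub_apply, PiLp.add_apply,
    PiLp.smul_apply, smul_eq_mul]
  ring

end Tensor

/-- If `u ∈ L^∞` admits at `x₀` the jump blow-up with data `(u⁺, u⁻, ν)` (with `u⁺ = u⁻`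
allowed) and `ρ ∈ K` is radial, then, writing `u_ℓ = u ∗ ρ_ℓ` and
`R^ℓ = (u ⊗ u) ∗ ρ_ℓ - u_ℓ ⊗ u_ℓ`, one has
`(R^ℓ ∗ ρ_ℓ)(x₀) → ᾱ (u⁺ - u⁻) ⊗ (u⁺ - u⁻)` as `ℓ → 0⁺`, where
`ᾱ = ∫_{B₁} α_ν(y)(1 - α_ν(y)) ρ(y) dy`. -/
theorem statement6 {d : ℕ} (u : EuclideanSpace ℝ (Fin d) → EuclideanSpace ℝ (Fin d))
    (hmeas : Measurable u) (hbd : ∃ C, ∀ x, ‖u x‖ ≤ C)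
    (x₀ : EuclideanSpace ℝ (Fin d))
    (up um : EuclideanSpace ℝ (Fin d)) (ν : EuclideanSpace ℝ (Fin d)) (hν : ‖ν‖ = 1)
    (hblow : HasBlowUp u x₀ (jumpFn up um ν))
    (ρ : EuclideanSpace ℝ (Fin d) → ℝ) (hρ : IsKernel d ρ)
    (hrad : ∃ g : ℝ → ℝ, ∀ z, ρ z = g ‖z‖) :
    Tendsto (fun ℓ : ℝ =>
        mollify ρ
          (fun x => mollify ρ (fun z => tensor (u z) (u z)) ℓ x
            - tensor (mollify ρ u ℓ x) (mollify ρ u ℓ x)) ℓ x₀)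
      (𝓝[>] (0:ℝ))
      (𝓝 ((∫ y in Metric.ball (0 : EuclideanSpace ℝ (Fin d)) 1,
            alphaNu ρ ν y * (1 - alphaNu ρ ν y) * ρ y) • tensor (up - um) (up - um))) := by
  obtain ⟨C, hC⟩ := hbd
  have hC0 : 0 ≤ C := (norm_nonneg _).trans (hC 0)
  have hu : StronglyMeasurable u := hmeas.stronglyMeasurable
  have hT : StronglyMeasurable fun x => tensor (u x) (u x) :=
    continuous_tensor_self.comp_stronglyMeasurable hu
  have hTC : ∀ x, ‖tensor (u x) (u x)‖ ≤ C * C := fun x =>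
    (norm_tensor_le _ _).trans (mul_le_mul (hC x) (hC x) (norm_nonneg _) hC0)
  set R : ℝ → EuclideanSpace ℝ (Fin d) → Fin d → Fin d → ℝ := fun ℓ x =>
    mollify ρ (fun z => tensor (u z) (u z)) ℓ x - tensor (mollify ρ u ℓ x) (mollify ρ u ℓ x)
  set I : ℝ := ∫ w, |ρ w|
  have hI : 0 ≤ I := integral_nonneg fun w => abs_nonneg _
  have hRm : ∀ ℓ, StronglyMeasurable (R ℓ) := fun ℓ =>
    (hρ.stronglyMeasurable_mollify hT ℓ).sub
      (continuous_tensor_self.comp_stronglyMeasurable (hρ.stronglyMeasurable_mollify hu ℓ))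
  have hRb : ∀ ℓ, 0 < ℓ → ∀ x, ‖R ℓ x‖ ≤ I * (C * C) + I * C * (I * C) := fun ℓ hℓ x => by
    have hm := hρ.norm_mollify_le hC hℓ x
    refine (norm_sub_le _ _).trans (add_le_add (hρ.norm_mollify_le hTC hℓ x) ?_)
    exact (norm_tensor_le _ _).trans (mul_le_mul hm hm (norm_nonneg _) (by positivity))
  have hRlim : ∀ y ∈ ball (0 : EuclideanSpace ℝ (Fin d)) 1,
      Tendsto (fun ℓ : ℝ => R ℓ (x₀ + ℓ • y)) (𝓝[>] 0)
        (𝓝 ((alphaNu ρ ν y * (1 - alphaNu ρ ν y)) • tensor (up - um) (up - um))) :=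
    fun y hy => by
      rw [← tensor_jump_defect]
      exact ((hblow.tensor_self hu hC).tendsto_mollify hρ hT hTC hy).sub
        ((continuous_tensor_self.tendsto _).comp (hblow.tendsto_mollify hρ hu hC hy))
  have hval : (∫ y in ball (0 : EuclideanSpace ℝ (Fin d)) 1,
        alphaNu ρ ν y * (1 - alphaNu ρ ν y) * ρ y) • tensor (up - um) (up - um)
      = ∫ y, ρ y • (alphaNu ρ ν (-y) * (1 - alphaNu ρ ν (-y))) • tensor (up - um) (up - um) := by
    rw [setIntegral_eq_integral_of_forall_compl_eq_zero
      fun y hy => by rw [hρ.eq_zero_of_notMem_ball hy, mul_zero], ← integral_smul_const,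
      ← integral_neg_eq_self]
    congr 1 with y : 1
    rw [hρ.even, mul_comm, mul_smul]
  rw [hval]
  refine Tendsto.congr' (f₁ := fun ℓ => ∫ y, ρ y • R ℓ (x₀ - ℓ • y)) ?_ ?_
  · filter_upwards [self_mem_nhdsWithin] with ℓ hℓ
    exact (mollify_eq_integral (R ℓ) hℓ x₀).symm
  · refine tendsto_integral_filter_of_dominated_convergence
      (fun y => |ρ y| * (I * (C * C) + I * C * (I * C))) (Eventually.of_forall fun ℓ => ?_) ?_
      (hρ.integrable.abs.mul_const _) (Eventually.of_forall fun y => ?_)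
    · exact hρ.smooth.continuous.aestronglyMeasurable.smul
        ((hRm ℓ).comp_measurable (by fun_prop)).aestronglyMeasurable
    · filter_upwards [self_mem_nhdsWithin] with ℓ hℓ
      refine Eventually.of_forall fun y => ?_
      rw [norm_smul, Real.norm_eq_abs]
      exact mul_le_mul_of_nonneg_left (hRb ℓ hℓ _) (abs_nonneg _)
    · by_cases hy : y ∈ ball (0 : EuclideanSpace ℝ (Fin d)) 1
      · have h := hRlim (-y) (by simpa using hy)
        simp only [smul_neg, ← sub_eq_add_neg] at h
        exact h.const_smul (ρ y)
      · simp only [hρ.eq_zero_of_notMem_ball hy, zero_smul, tendsto_const_nhds]
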